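/- The map f₁ : W ⊗ V₂ → V₃ is surjective, and dim_ℂ ker f₁ = (3g−5)(g−1). -/

import Mathlib

set_option synthInstance.maxHeartbeats 400000
set_option maxHeartbeats 1000000

noncomputable section

open scoped TensorProduct

/-- The coordinate ring `A = ℂ[u,ε]/(ε²)` of the chart `U` of the balanced ribbon. -/
def A : Type := DualNumber (Polynomial ℂ)

instance : CommRing A := inferInstanceAs (CommRing (DualNumber (Polynomial ℂ)))
instance : Algebra ℂ A := inferInstanceAs (Algebra ℂ (DualNumber (Polynomial ℂ)))

def uu : A := TrivSqZeroExt.inl Polynomial.X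
def ee : A := DualNumber.eps

/-- The restrictions to `U` of the standard basis of `H⁰(ω)` of the balanced ribbon. -/
def x (k i : ℕ) : A :=
  if i ≤ k then uu ^ i else uu ^ i + ((i - k : ℕ) : A) * uu ^ (i - k - 1) * ee

/-- `V_m`: the span of the degree-`m` monomials in `x_0, …, x_{2k}`. -/
def V (k m : ℕ) : Submodule ℂ A :=
  Submodule.span ℂ {a | ∃ f : Fin m → ℕ, (∀ j, f j ≤ 2 * k) ∧ a = ∏ j, x k (f j)}

/-- `W = span ℂ {x_0, …, x_{2k}}`. -/
def W (k : ℕ) : Submodule ℂ A := Submodule.span ℂ (x k '' Set.Iic (2 * k))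

def xW (k i : ℕ) : ↥(W k) :=
  if h : i ≤ 2 * k then ⟨x k i, Submodule.subset_span ⟨i, h, rfl⟩⟩ else 0

def xV2 (k i j : ℕ) : ↥(V k 2) :=
  if h : i ≤ 2 * k ∧ j ≤ 2 * k then
    ⟨x k i * x k j, Submodule.subset_span ⟨![i, j], by
      refine ⟨?_, ?_⟩
      · intro t
        fin_cases t
        · simpa using h.1
        · simpa using h.2
      · simp [Fin.prod_univ_two]⟩⟩
  else 0

/-- The Koszul differential `f₁ : W ⊗ V₂ → V₃ ⊆ A`, `x ⊗ q ↦ x·q`. -/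
def f1 (k : ℕ) : (↥(W k) ⊗[ℂ] ↥(V k 2)) →ₗ[ℂ] A :=
  TensorProduct.lift (((LinearMap.mul ℂ A).comp (W k).subtype).compl₂ (V k 2).subtype)

/-- The image under the Koszul differential `f₂` of the cosyzygy `(x_a ∧ x_b) ⊗ x_c`,
namely `x_b ⊗ x_a x_c − x_a ⊗ x_b x_c ∈ W ⊗ V₂`. -/
def cosz (k a b c : ℕ) : ↥(W k) ⊗[ℂ] ↥(V k 2) :=
  xW k b ⊗ₜ[ℂ] xV2 k a c - xW k a ⊗ₜ[ℂ] xV2 k b c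

/-- A finite set `S` of triples is a monomial basis of cosyzygies if the family
`f₂((x_a ∧ x_b) ⊗ x_c) = x_b ⊗ x_a x_c − x_a ⊗ x_b x_c`, `(a,b,c) ∈ S`,
is a basis of `ker f₁`. -/
def IsMonomialBasisOfCosyzygies (k : ℕ) (S : Finset (ℕ × ℕ × ℕ)) : Prop :=
  LinearIndependent ℂ (fun t : S => cosz k t.1.1 t.1.2.1 t.1.2.2) ∧
  Submodule.span ℂ ((fun t : ℕ × ℕ × ℕ => cosz k t.1 t.2.1 t.2.2) '' ↑S) =
    LinearMap.ker (f1 k)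

/-- The number of occurrences of the index `i` among the entries of the triples of `S`. -/
def occ (S : Finset (ℕ × ℕ × ℕ)) (i : ℕ) : ℕ :=
  ∑ t ∈ S, ((if t.1 = i then 1 else 0) + (if t.2.1 = i then 1 else 0) +
    (if t.2.2 = i then 1 else 0))

lemma ee_mul_ee : ee * ee = 0 :=
  DualNumber.eps_mul_eps (R := Polynomial ℂ)

/-- The body `ℂ[u]`-component of an element of `A`. -/
def bodyMap : A →ₗ[ℂ] Polynomial ℂ :=
  (TrivSqZeroExt.fstHom ℂ (Polynomial ℂ) (Polynomial ℂ)).toLinearMap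

/-- The coefficient of `ε` in an element of `A`. -/
def epsMap : A →ₗ[ℂ] Polynomial ℂ :=
  (TrivSqZeroExt.sndHom (Polynomial ℂ) (Polynomial ℂ)).restrictScalars ℂ

lemma uu_pow (n : ℕ) : uu ^ n = (TrivSqZeroExt.inl (Polynomial.X ^ n) : DualNumber (Polynomial ℂ)) :=
  TrivSqZeroExt.inl_pow (R := Polynomial ℂ) (M := Polynomial ℂ) Polynomial.X n

lemma uu_pow_mul_ee (n : ℕ) :
    uu ^ n * ee = (TrivSqZeroExt.inr (Polynomial.X ^ n) : DualNumber (Polynomial ℂ)) := by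
  rw [uu_pow]
  refine (TrivSqZeroExt.inl_mul_inr (R := Polynomial ℂ) (M := Polynomial ℂ) _ _).trans ?_
  simp

lemma bodyMap_uu_pow (n : ℕ) : bodyMap (uu ^ n) = Polynomial.X ^ n := by
  rw [uu_pow]; rfl

lemma bodyMap_uu_pow_mul_ee (n : ℕ) : bodyMap (uu ^ n * ee) = 0 := by
  rw [uu_pow_mul_ee]; rfl

lemma epsMap_uu_pow_mul_ee (n : ℕ) : epsMap (uu ^ n * ee) = Polynomial.X ^ n := by
  rw [uu_pow_mul_ee]; rfl

/-- The homogeneous element `uⁿ + c uⁿ⁻ᵏ⁻¹ ε` of weight `n`. -/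
def homog (k n c : ℕ) : A := uu ^ n + (c : ℂ) • (uu ^ (n - k - 1) * ee)

lemma x_eq_homog (k i : ℕ) : x k i = homog k i (i - k) := by
  unfold x homog
  split_ifs with h
  · simp [Nat.sub_eq_zero_of_le h]
  · rw [Nat.cast_smul_eq_nsmul, nsmul_eq_mul, mul_assoc]

lemma homog_sub_homog (k n c d : ℕ) :
    homog k n c - homog k n d = ((c : ℂ) - d) • (uu ^ (n - k - 1) * ee) := by
  unfold homog
  rw [sub_smul]; abel

lemma bodyMap_homog (k n c : ℕ) : bodyMap (homog k n c) = Polynomial.X ^ n := by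
  simp [homog, bodyMap_uu_pow, bodyMap_uu_pow_mul_ee]

lemma homog_mul_homog {k n i c d : ℕ} (hc : n ≤ k → c = 0) (hd : i ≤ k → d = 0) :
    homog k n c * homog k i d = homog k (n + i) (c + d) := by
  have h₁ : (c : A) * (uu ^ (n - k - 1) * uu ^ i) = c * uu ^ (n + i - k - 1) := by
    rcases le_or_gt n k with h | h
    · simp [hc h]
    · rw [← pow_add]; congr 2; omega
  have h₂ : (d : A) * (uu ^ (i - k - 1) * uu ^ n) = d * uu ^ (n + i - k - 1) := by
    rcases le_or_gt i k with h | h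
    · simp [hd h]
    · rw [← pow_add]; congr 2; omega
  simp only [homog, Nat.cast_smul_eq_nsmul, nsmul_eq_mul, pow_add]
  push_cast
  linear_combination ee * h₁ + ee * h₂ +
    (c * d * uu ^ (n - k - 1) * uu ^ (i - k - 1)) * ee_mul_ee

lemma uu_pow_mul_ee_mul_homog (k j i c : ℕ) :
    uu ^ j * ee * homog k i c = uu ^ (j + i) * ee := by
  simp only [homog, Nat.cast_smul_eq_nsmul, nsmul_eq_mul, pow_add]
  linear_combination (c * uu ^ j * uu ^ (i - k - 1)) * ee_mul_ee

/-- A homogeneous basis of `W ^ (m + 1)`. -/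
def powBasis (k m : ℕ) : Fin (2 * ((m + 1) * k) + 1) ⊕ Fin (2 * (m * k) - 1) → A :=
  Sum.elim (fun n => homog k n (n - (m + 1) * k)) (fun j => uu ^ (j : ℕ) * ee)

lemma linearIndependent_powBasis (k m : ℕ) : LinearIndependent ℂ (powBasis k m) := by
  have hX (N : ℕ) (g : Fin N → ℂ) (hg : ∑ n, g n • (Polynomial.X : Polynomial ℂ) ^ (n : ℕ) = 0)
      (n : Fin N) : g n = 0 := by
    have := congrArg (Polynomial.coeff · (n : ℕ)) hg
    simpa [Polynomial.finsetSum_coeff, Polynomial.coeff_X_pow, Fin.val_inj] using this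
  rw [Fintype.linearIndependent_iff]
  intro g hg
  simp only [powBasis, Fintype.sum_sum_type, Sum.elim_inl, Sum.elim_inr] at hg
  have hl : ∀ n, g (Sum.inl n) = 0 := by
    refine hX _ (fun n => g (Sum.inl n)) ?_
    simpa [bodyMap_homog, bodyMap_uu_pow_mul_ee] using congrArg bodyMap hg
  have hr : ∀ j, g (Sum.inr j) = 0 := by
    refine hX _ (fun j => g (Sum.inr j)) ?_
    simpa [hl, epsMap_uu_pow_mul_ee] using congrArg epsMap hg
  rintro (n | j)
  exacts [hl n, hr j]

lemma homog_mem_span_powBasis {k m n : ℕ} (hn : n ≤ 2 * ((m + 1) * k)) :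
    homog k n (n - (m + 1) * k) ∈ Submodule.span ℂ (Set.range (powBasis k m)) :=
  Submodule.subset_span ⟨Sum.inl ⟨n, by omega⟩, rfl⟩

lemma uu_pow_mul_ee_mem_span_powBasis {k m j : ℕ} (hj : j + 2 ≤ 2 * (m * k)) :
    uu ^ j * ee ∈ Submodule.span ℂ (Set.range (powBasis k m)) :=
  Submodule.subset_span ⟨Sum.inr ⟨j, by omega⟩, rfl⟩

lemma W_eq_span_powBasis (k : ℕ) : W k = Submodule.span ℂ (Set.range (powBasis k 0)) := by
  apply le_antisymm <;> refine Submodule.span_le.2 ?_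
  · rintro _ ⟨i, hi, rfl⟩
    rw [x_eq_homog]
    simpa using homog_mem_span_powBasis (k := k) (m := 0) (n := i) (by simpa using hi)
  · rintro _ ⟨n | j, rfl⟩
    · refine Submodule.subset_span ⟨n, ?_, ?_⟩
      · have := n.2
        simp only [Set.mem_Iic]; omega
      · simp [powBasis, x_eq_homog]
    · exact absurd j.2 (by simp)

lemma x_mem_W {k i : ℕ} (hi : i ≤ 2 * k) : x k i ∈ W k := Submodule.subset_span ⟨i, hi, rfl⟩

lemma span_powBasis_mul_W_le (k m : ℕ) :
    Submodule.span ℂ (Set.range (powBasis k m)) * W k ≤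
      Submodule.span ℂ (Set.range (powBasis k (m + 1))) := by
  have h₁ : (m + 1) * k = m * k + k := by ring
  have h₂ : (m + 1 + 1) * k = m * k + k + k := by ring
  rw [W, Submodule.span_mul_span, Submodule.span_le]
  rintro _ ⟨_, ⟨n | j, rfl⟩, _, ⟨i, hi, rfl⟩, rfl⟩ <;> simp only [Set.mem_Iic] at hi <;>
    simp only [powBasis, Sum.elim_inl, Sum.elim_inr, x_eq_homog, SetLike.mem_coe]
  · obtain ⟨n, hn⟩ := n
    dsimp only
    rw [homog_mul_homog (by rw [h₁]; omega) (by omega),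
      ← sub_add_cancel (homog k (n + i) _) (homog k (n + i) (n + i - (m + 1 + 1) * k))]
    refine add_mem ?_ (homog_mem_span_powBasis (by omega))
    rw [homog_sub_homog]
    by_cases h : k < n + i ∧ n + i < 2 * (m * k) + 3 * k
    · exact Submodule.smul_mem _ _ (uu_pow_mul_ee_mem_span_powBasis (by omega))
    · have : n - (m + 1) * k + (i - k) = n + i - (m + 1 + 1) * k := by
        rw [h₁, h₂]; omega
      simp [this]
  · rw [uu_pow_mul_ee_mul_homog]
    exact uu_pow_mul_ee_mem_span_powBasis (by omega)

lemma homog_mem_span_powBasis_mul_W {k m n i : ℕ} (hn : n ≤ 2 * ((m + 1) * k)) (hi : i ≤ 2 * k) :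
    homog k (n + i) (n - (m + 1) * k + (i - k)) ∈
      Submodule.span ℂ (Set.range (powBasis k m)) * W k := by
  have h₁ : (m + 1) * k = m * k + k := by ring
  rw [← homog_mul_homog (by rw [h₁]; omega) (by omega), ← x_eq_homog]
  exact Submodule.mul_mem_mul (homog_mem_span_powBasis hn) (x_mem_W hi)

lemma uu_pow_mul_ee_mem_span_powBasis_mul_W {k m j : ℕ} (hk : 1 ≤ k)
    (hj : j + 2 ≤ 2 * ((m + 1) * k)) :
    uu ^ j * ee ∈ Submodule.span ℂ (Set.range (powBasis k m)) * W k := by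
  have h₁ : (m + 1) * k = m * k + k := by ring
  suffices H : ∃ c, homog k (j + k + 1) (c + 1) ∈ Submodule.span ℂ (Set.range (powBasis k m)) * W k
      ∧ homog k (j + k + 1) c ∈ Submodule.span ℂ (Set.range (powBasis k m)) * W k by
    obtain ⟨c, hc₁, hc₀⟩ := H
    have := sub_mem hc₁ hc₀
    rw [homog_sub_homog, show j + k + 1 - k - 1 = j by omega] at this
    simpa using this
  refine ⟨j + 1 - (m + 1) * k, ?_, ?_⟩
  · rcases le_or_gt (j + 1) ((m + 1) * k) with h | h
    · convert homog_mem_span_powBasis_mul_W (k := k) (m := m) (n := j) (i := k + 1)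
        (by omega) (by omega) using 2 <;> omega
    · convert homog_mem_span_powBasis_mul_W (k := k) (m := m) (n := j + 2) (i := k - 1)
        (by omega) (by omega) using 2 <;> omega
  · convert homog_mem_span_powBasis_mul_W (k := k) (m := m) (n := j + 1) (i := k)
      (by omega) (by omega) using 2 <;> omega

lemma span_powBasis_mul_W {k : ℕ} (hk : 1 ≤ k) (m : ℕ) :
    Submodule.span ℂ (Set.range (powBasis k m)) * W k =
      Submodule.span ℂ (Set.range (powBasis k (m + 1))) := by
  have h₁ : (m + 1) * k = m * k + k := by ring
  have h₂ : (m + 1 + 1) * k = m * k + k + k := by ring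
  refine le_antisymm (span_powBasis_mul_W_le k m) (Submodule.span_le.2 ?_)
  rintro _ ⟨n | j, rfl⟩ <;> simp only [powBasis, Sum.elim_inl, Sum.elim_inr, SetLike.mem_coe]
  · obtain ⟨n, hn⟩ := n
    dsimp only
    obtain ⟨p, i, rfl, hp, hi, hpi⟩ : ∃ p i, n = p + i ∧ p ≤ 2 * ((m + 1) * k) ∧ i ≤ 2 * k ∧
        (p = 2 * ((m + 1) * k) ∨ i = 0) :=
      ⟨min n (2 * ((m + 1) * k)), n - min n (2 * ((m + 1) * k)), by omega⟩
    rw [← sub_add_cancel (homog k (p + i) _) (homog k (p + i) (p - (m + 1) * k + (i - k)))]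
    refine add_mem ?_ (homog_mem_span_powBasis_mul_W hp hi)
    rw [homog_sub_homog]
    by_cases h : k < p + i ∧ p + i < 2 * (m * k) + 3 * k
    · exact Submodule.smul_mem _ _ (uu_pow_mul_ee_mem_span_powBasis_mul_W hk (by omega))
    · have : p + i - (m + 1 + 1) * k = p - (m + 1) * k + (i - k) := by
        rw [h₁, h₂]; omega
      simp [this]
  · exact uu_pow_mul_ee_mem_span_powBasis_mul_W hk (by omega)

lemma W_pow_succ {k : ℕ} (hk : 1 ≤ k) (m : ℕ) :
    W k ^ (m + 1) = Submodule.span ℂ (Set.range (powBasis k m)) := by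
  induction m with
  | zero => exact (pow_one _).trans (W_eq_span_powBasis k)
  | succ m ih => rw [pow_succ, ih, span_powBasis_mul_W hk]

lemma finite_W_pow_succ {k : ℕ} (hk : 1 ≤ k) (m : ℕ) :
    Module.Finite ℂ ↥(W k ^ (m + 1)) := by
  rw [W_pow_succ hk]
  exact FiniteDimensional.span_of_finite ℂ (Set.finite_range _)

lemma finrank_W_pow_succ {k : ℕ} (hk : 1 ≤ k) (m : ℕ) :
    Module.finrank ℂ ↥(W k ^ (m + 1)) = 2 * ((m + 1) * k) + 1 + (2 * (m * k) - 1) := by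
  rw [W_pow_succ hk, finrank_span_eq_card (linearIndependent_powBasis k m)]
  simp

lemma V_eq_W_pow (k m : ℕ) : V k m = W k ^ m := by
  rw [V, W, Submodule.span_pow]
  congr 1
  ext a
  simp only [Set.mem_ofPred_eq, Set.mem_pow, List.prod_ofFn]
  constructor
  · rintro ⟨f, hf, rfl⟩
    exact ⟨fun j => ⟨x k (f j), f j, hf j, rfl⟩, rfl⟩
  · rintro ⟨f, rfl⟩
    choose g hg hgf using fun j => (f j).2
    exact ⟨g, hg, by simp [hgf]⟩

lemma range_f1 (k : ℕ) : LinearMap.range (f1 k) = W k * V k 2 := by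
  apply le_antisymm
  · rintro _ ⟨t, rfl⟩
    induction t with
    | zero => simp
    | tmul w v => exact Submodule.mul_mem_mul w.2 v.2
    | add a b ha hb => rw [map_add]; exact add_mem ha hb
  · rw [Submodule.mul_le]
    exact fun w hw v hv => ⟨⟨w, hw⟩ ⊗ₜ ⟨v, hv⟩, rfl⟩

/-- `f₁ : W ⊗ V₂ → V₃` is surjective, and `dim ker f₁ = (3g−5)(g−1)` where `g = 2k+1`. -/
theorem stmt_9 (k : ℕ) (hk : 2 ≤ k) :
    LinearMap.range (f1 k) = V k 3 ∧
    Module.finrank ℂ ↥(LinearMap.ker (f1 k)) =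
      (3 * (2 * k + 1) - 5) * ((2 * k + 1) - 1) := by
  have hk₁ : 1 ≤ k := by omega
  have hrange : LinearMap.range (f1 k) = V k 3 := by
    rw [range_f1, V_eq_W_pow, V_eq_W_pow, ← pow_succ']
  refine ⟨hrange, ?_⟩
  have hW : W k ^ (0 + 1) = W k := pow_one _
  have : Module.Finite ℂ ↥(W k) := by
    have h := finite_W_pow_succ hk₁ 0
    rwa [hW] at h
  have : Module.Finite ℂ ↥(V k 2) := by rw [V_eq_W_pow]; exact finite_W_pow_succ hk₁ 1
  have h₁ : Module.finrank ℂ ↥(W k) = 2 * k + 1 := by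
    have h := finrank_W_pow_succ hk₁ 0
    rw [hW] at h
    omega
  have h₂ : Module.finrank ℂ ↥(V k 2) = 6 * k := by
    rw [V_eq_W_pow, finrank_W_pow_succ hk₁ 1]; omega
  have h₃ : Module.finrank ℂ ↥(V k 3) = 10 * k := by
    rw [V_eq_W_pow, finrank_W_pow_succ hk₁ 2]; omega
  have h := LinearMap.finrank_range_add_finrank_ker (K := ℂ) (V := ↥(W k) ⊗[ℂ] ↥(V k 2)) (V₂ := A) (f1 k)
  rw [hrange, h₃, Module.finrank_tensorProduct, h₁, h₂] at h
  obtain ⟨l, rfl⟩ : ∃ l, k = l + 1 := ⟨k - 1, by omega⟩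
  rw [show 3 * (2 * (l + 1) + 1) - 5 = 6 * l + 4 by omega, Nat.add_sub_cancel]
  linarith
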